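/- arXiv:1202.3892 — 13 statements merged into one kernel-verified Lean document; each statement's English description precedes it below -/
import Mathlib

section
/- Let k₁ > 0 and k₂ ≥ 0, and define F : ℝ³ → ℝ³ by F(a,b,c) = (k₂c − k₁ab, k₂c − k₁ab, k₁ab − k₂c). Then for every A ∈ ℝ and α ∈ ℝ there exists x ∈ ℤ₊³ such that (x, F(x)) > A + α·‖x‖². In other words, the one-sided bound (x,F(x)) ≤ A + α‖x‖² fails on ℤ₊³ for every choice of constants. -/
/-- The closed reversible reaction A+B ⇌ C admits no one-sided bound
(x,F(x)) ≤ A + α‖x‖² on ℤ₊³ (Proposition 3.3 of the paper). -/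
theorem stmt_4 (k₁ k₂ : ℝ) (hk₁ : 0 < k₁) (hk₂ : 0 ≤ k₂)
    (F : (Fin 3 → ℝ) → Fin 3 → ℝ)
    (hF0 : ∀ x, F x 0 = k₂ * x 2 - k₁ * x 0 * x 1)
    (hF1 : ∀ x, F x 1 = k₂ * x 2 - k₁ * x 0 * x 1)
    (hF2 : ∀ x, F x 2 = k₁ * x 0 * x 1 - k₂ * x 2) :
    ∀ A α : ℝ, ∃ x : Fin 3 → ℝ, (∀ i, ∃ n : ℕ, x i = n) ∧
      A + α * (∑ i, x i ^ 2) < ∑ i, x i * F x i := by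
  intro A α
  obtain ⟨n, hn⟩ := exists_nat_gt ((|A| + 11 * |α| + 3 * k₂) / k₁)
  rw [div_lt_iff₀ hk₁] at hn
  have hA := abs_nonneg A
  have hα := abs_nonneg α
  have hn1 : (1 : ℝ) ≤ n := by
    rcases Nat.eq_zero_or_pos n with h | h
    · subst h
      norm_num at hn
      linarith
    · exact_mod_cast h
  refine ⟨![(n : ℝ), n, 3 * n], ?_, ?_⟩
  · intro i
    fin_cases i
    · exact ⟨n, rfl⟩
    · exact ⟨n, rfl⟩
    · exact ⟨3 * n, by simp⟩
  · simp only [Fin.sum_univ_three, hF0, hF1, hF2]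
    simp only [Matrix.cons_val]
    have hsq : (1 : ℝ) ≤ (n : ℝ) ^ 2 := one_le_pow₀ hn1
    have h1 : (n : ℝ) ^ 2 * (|A| + 11 * |α| + 3 * k₂) < (n : ℝ) ^ 2 * (n * k₁) :=
      mul_lt_mul_of_pos_left hn (by linarith)
    have h2 : A ≤ (n : ℝ) ^ 2 * |A| := by nlinarith [le_abs_self A]
    have h3 : (n : ℝ) ^ 2 * α ≤ (n : ℝ) ^ 2 * |α| :=
      mul_le_mul_of_nonneg_left (le_abs_self α) (by linarith)
    nlinarith
end

section
/- Let k₁ > 0 and k₂, k₃, k₄ ≥ 0, and define F : ℝ³ → ℝ³ by F(a,b,c) = (k₂c − k₁ab, k₂c − k₁ab, k₁ab − k₂c − k₃c + k₄). Then for every A ∈ ℝ and α ∈ ℝ there exists x ∈ ℤ₊³ such that (x, F(x)) > A + α·‖x‖². In other words, the one-sided bound (x,F(x)) ≤ A + α‖x‖² fails on ℤ₊³ for every choice of constants. -/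
/-- The open reversible network A+B ⇌ C ⇌ ∅ admits no one-sided bound
(x,F(x)) ≤ A + α‖x‖² on ℤ₊³ (Proposition 3.3 of the paper). -/
theorem stmt_5 (k₁ k₂ k₃ k₄ : ℝ) (hk₁ : 0 < k₁) (hk₂ : 0 ≤ k₂) (hk₃ : 0 ≤ k₃) (hk₄ : 0 ≤ k₄)
    (F : (Fin 3 → ℝ) → Fin 3 → ℝ)
    (hF0 : ∀ x, F x 0 = k₂ * x 2 - k₁ * x 0 * x 1)
    (hF1 : ∀ x, F x 1 = k₂ * x 2 - k₁ * x 0 * x 1)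
    (hF2 : ∀ x, F x 2 = k₁ * x 0 * x 1 - k₂ * x 2 - k₃ * x 2 + k₄) :
    ∀ A α : ℝ, ∃ x : Fin 3 → ℝ, (∀ i, ∃ n : ℕ, x i = n) ∧
      A + α * (∑ i, x i ^ 2) < ∑ i, x i * F x i := by
  intro A α
  obtain ⟨n, hn⟩ := exists_nat_gt ((3 * k₂ + 9 * k₃ + 11 * |α| + |A|) / k₁)
  rw [div_lt_iff₀ hk₁] at hn
  have hA := le_abs_self A
  have hα := le_abs_self α
  have hA0 := abs_nonneg A
  have hα0 := abs_nonneg α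
  have hpos : (0 : ℝ) < n := by
    by_contra h
    have h0 : (n : ℝ) * k₁ ≤ 0 := mul_nonpos_of_nonpos_of_nonneg (not_lt.mp h) hk₁.le
    linarith
  have h1 : (1 : ℝ) ≤ n := by
    have : 0 < n := by exact_mod_cast hpos
    exact_mod_cast this
  refine ⟨![(n : ℝ), n, 3 * n], ?_, ?_⟩
  · intro i
    fin_cases i
    · exact ⟨n, rfl⟩
    · exact ⟨n, rfl⟩
    · exact ⟨3 * n, by simp⟩
  · simp only [Fin.sum_univ_three, hF0, hF1, hF2]
    simp only [Matrix.cons_val_zero, Matrix.cons_val_one, Matrix.cons_val]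
    have hsq : (1 : ℝ) ≤ (n : ℝ) ^ 2 := one_le_pow₀ h1
    have e1 := mul_lt_mul_of_pos_right hn (by positivity : (0 : ℝ) < (n : ℝ) ^ 2)
    have e2 := mul_le_mul_of_nonneg_left hsq hA0
    have e3 := mul_le_mul_of_nonneg_right hα (by positivity : (0 : ℝ) ≤ (n : ℝ) ^ 2)
    have e4 := mul_nonneg hk₄ hpos.le
    nlinarith
end

section
/- Let D ≥ 1, let F : ℝ^D → ℝ^D, and let M, μ ∈ ℝ be such that for all x, y in the nonnegative orthant ℝ₊^D one has (x − y, F(x) − F(y)) ≤ (M + μ·‖x+y‖₁)·‖x−y‖². Let x, y : [0,T] → ℝ₊^D be differentiable functions satisfying x'(t) = F(x(t)) and y'(t) = F(y(t)) for all t ∈ [0,T]. Then for all t ∈ [0,T], ‖x(t) − y(t)‖ ≤ ‖x(0) − y(0)‖ · exp( ∫₀ᵗ (M + μ·‖x(s)+y(s)‖₁) ds ). In particular, solutions of the ODE x' = F(x) remaining in ℝ₊^D are unique. -/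
/-- Continuity with respect to initial data for the reaction rate equation
x' = F(x) under the one-sided condition (x−y, F(x)−F(y)) ≤ (M + μ‖x+y‖₁)‖x−y‖²
on the nonnegative orthant (Theorem 3.4 of the paper); in particular, solutions
remaining in the nonnegative orthant are unique. -/
theorem stmt_6 (D : ℕ) (hD : 1 ≤ D) (T : ℝ) (F : (Fin D → ℝ) → Fin D → ℝ) (M μ : ℝ)
    (hF : ∀ a b : Fin D → ℝ, (∀ i, 0 ≤ a i) → (∀ i, 0 ≤ b i) →
      ∑ i, (a i - b i) * (F a i - F b i) ≤
        (M + μ * ∑ i, |a i + b i|) * ∑ i, (a i - b i) ^ 2)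
    (x y : ℝ → Fin D → ℝ)
    (hx : ∀ t ∈ Set.Icc (0:ℝ) T, HasDerivWithinAt x (F (x t)) (Set.Icc 0 T) t)
    (hy : ∀ t ∈ Set.Icc (0:ℝ) T, HasDerivWithinAt y (F (y t)) (Set.Icc 0 T) t)
    (hxpos : ∀ t ∈ Set.Icc (0:ℝ) T, ∀ i, 0 ≤ x t i)
    (hypos : ∀ t ∈ Set.Icc (0:ℝ) T, ∀ i, 0 ≤ y t i) :
    (∀ t ∈ Set.Icc (0:ℝ) T,
      Real.sqrt (∑ i, (x t i - y t i) ^ 2) ≤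
        Real.sqrt (∑ i, (x 0 i - y 0 i) ^ 2) *
          Real.exp (∫ s in (0:ℝ)..t, (M + μ * ∑ i, |x s i + y s i|))) ∧
    (x 0 = y 0 → ∀ t ∈ Set.Icc (0:ℝ) T, x t = y t) := by
  have key : ∀ t ∈ Set.Icc (0:ℝ) T,
      Real.sqrt (∑ i, (x t i - y t i) ^ 2) ≤
        Real.sqrt (∑ i, (x 0 i - y 0 i) ^ 2) *
          Real.exp (∫ s in (0:ℝ)..t, (M + μ * ∑ i, |x s i + y s i|)) := by
    intro t ht
    have hT : 0 ≤ T := ht.1.trans ht.2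
    have hxc : ContinuousOn x (Set.Icc 0 T) := fun s hs => (hx s hs).continuousWithinAt
    have hyc : ContinuousOn y (Set.Icc 0 T) := fun s hs => (hy s hs).continuousWithinAt
    have hxi : ∀ i, ContinuousOn (fun s => x s i) (Set.Icc 0 T) :=
      fun i => (continuous_apply i).comp_continuousOn hxc
    have hyi : ∀ i, ContinuousOn (fun s => y s i) (Set.Icc 0 T) :=
      fun i => (continuous_apply i).comp_continuousOn hyc
    set k : ℝ → ℝ := fun s => M + μ * ∑ i, |x s i + y s i| with hk
    have hkc : ContinuousOn k (Set.Icc 0 T) :=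
      continuousOn_const.add (continuousOn_const.mul
        (continuousOn_finsetSum _ fun i _ => ((hxi i).add (hyi i)).abs))
    set g : ℝ → ℝ := fun s => ∫ r in (0:ℝ)..s, k r with hg
    have hgc : ContinuousOn g (Set.Icc 0 T) := by
      have := intervalIntegral.continuousOn_primitive_interval (μ := MeasureTheory.volume)
        (a := (0:ℝ)) (b := T) (f := k)
        (by rw [Set.uIcc_of_le hT]; exact hkc.integrableOn_Icc)
      rwa [Set.uIcc_of_le hT] at this
    have hgd : ∀ s ∈ Set.Ioo (0:ℝ) T, HasDerivAt g (k s) s := by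
      intro s hs
      have hkI : ContinuousOn k (Set.Ioo 0 T) := hkc.mono Set.Ioo_subset_Icc_self
      refine intervalIntegral.integral_hasDerivAt_right ?_ ?_ ?_
      · apply ContinuousOn.intervalIntegrable
        rw [Set.uIcc_of_le hs.1.le]
        exact hkc.mono (Set.Icc_subset_Icc_right hs.2.le)
      · exact hkI.stronglyMeasurableAtFilter isOpen_Ioo s hs
      · exact hkI.continuousAt (isOpen_Ioo.mem_nhds hs)
    set u : ℝ → ℝ := fun s => ∑ i, (x s i - y s i) ^ 2 with hu
    have huc : ContinuousOn u (Set.Icc 0 T) :=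
      continuousOn_finsetSum _ fun i _ => ((hxi i).sub (hyi i)).pow 2
    have hud : ∀ s ∈ Set.Ioo (0:ℝ) T,
        HasDerivAt u (2 * ∑ i, (x s i - y s i) * (F (x s) i - F (y s) i)) s := by
      intro s hs
      have hn : Set.Icc (0:ℝ) T ∈ nhds s := Icc_mem_nhds hs.1 hs.2
      have hs' := Set.Ioo_subset_Icc_self hs
      have h1 := hasDerivAt_pi.1 ((hx s hs').hasDerivAt hn)
      have h2 := hasDerivAt_pi.1 ((hy s hs').hasDerivAt hn)
      have h3 := HasDerivAt.fun_sum (u := Finset.univ)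
        (fun i _ => ((h1 i).fun_sub (h2 i)).fun_pow 2)
      refine h3.congr_deriv ?_
      rw [Finset.mul_sum]
      refine Finset.sum_congr rfl fun i _ => ?_
      push_cast
      ring
    have hhd : ∀ s ∈ Set.Ioo (0:ℝ) T, HasDerivAt (fun s => u s * Real.exp (-2 * g s))
        ((2 * ∑ i, (x s i - y s i) * (F (x s) i - F (y s) i)) * Real.exp (-2 * g s)
          + u s * (Real.exp (-2 * g s) * (-2 * k s))) s := fun s hs =>
      (hud s hs).fun_mul ((hgd s hs).const_mul (-2)).exp
    have hanti : AntitoneOn (fun s => u s * Real.exp (-2 * g s)) (Set.Icc 0 T) := by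
      apply antitoneOn_of_deriv_nonpos (convex_Icc 0 T)
      · exact huc.mul (continuousOn_const.mul hgc).rexp
      · rw [interior_Icc]
        exact fun s hs => (hhd s hs).differentiableAt.differentiableWithinAt
      · rw [interior_Icc]
        intro s hs
        rw [(hhd s hs).deriv]
        have hs' := Set.Ioo_subset_Icc_self hs
        have h1 : ∑ i, (x s i - y s i) * (F (x s) i - F (y s) i) ≤ k s * u s :=
          hF (x s) (y s) (hxpos s hs') (hypos s hs')
        have h2 := mul_le_mul_of_nonneg_right h1 (Real.exp_pos (-2 * g s)).le
        linarith
    have h0 := hanti (Set.left_mem_Icc.2 hT) ht ht.1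
    have hg0 : g 0 = 0 := by simp [hg]
    simp only [hg0, mul_zero, Real.exp_zero, mul_one] at h0
    have hexp : Real.exp (-2 * g t) * Real.exp (g t) ^ 2 = 1 := by
      rw [pow_two, ← Real.exp_add, ← Real.exp_add, ← Real.exp_zero]
      congr 1
      ring
    have h1 : u t ≤ u 0 * Real.exp (g t) ^ 2 := by
      calc u t = u t * Real.exp (-2 * g t) * Real.exp (g t) ^ 2 := by
            rw [mul_assoc, hexp, mul_one]
        _ ≤ _ := mul_le_mul_of_nonneg_right h0 (by positivity)
    have hu0 : 0 ≤ u 0 := Finset.sum_nonneg fun i _ => sq_nonneg _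
    calc Real.sqrt (u t) ≤ Real.sqrt (u 0 * Real.exp (g t) ^ 2) := Real.sqrt_le_sqrt h1
      _ = Real.sqrt (u 0) * Real.exp (g t) := by
        rw [Real.sqrt_mul hu0, Real.sqrt_sq (Real.exp_pos _).le]
  refine ⟨key, fun h t ht => ?_⟩
  have h1 := key t ht
  rw [h] at h1
  simp only [sub_self, ne_eq, OfNat.ofNat_ne_zero, not_false_eq_true, zero_pow,
    Finset.sum_const_zero, Real.sqrt_zero, zero_mul] at h1
  have h2 := Real.sqrt_eq_zero'.1 (le_antisymm h1 (Real.sqrt_nonneg _))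
  have h3 := (Finset.sum_eq_zero_iff_of_nonneg (fun i _ => sq_nonneg (x t i - y t i))).1
    (le_antisymm h2 (Finset.sum_nonneg fun i _ => sq_nonneg _))
  funext i
  exact sub_eq_zero.1 (pow_eq_zero_iff two_ne_zero |>.1 (h3 i (Finset.mem_univ i)))
end

section
/- Let k ≥ 0, let ν ∈ ℝ^D, let n ∈ {1,…,D}, and define F : ℝ^D → ℝ^D by F(x) = −ν·(k·xₙ). Then for all x, y ∈ ℝ^D, (x − y, F(x) − F(y)) ≤ (k/2)·(−νₙ + ‖ν‖)·‖x − y‖². Equivalently, for every v ∈ ℝ^D, −k·vₙ·(ν, v) ≤ (k/2)·(−νₙ + ‖ν‖)·‖v‖². -/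
theorem stmt_9_aux (D : ℕ) (ν v : Fin D → ℝ) (n : Fin D) :
    ν n * ∑ i, v i ^ 2 - 2 * v n * ∑ i, ν i * v i ≤
      Real.sqrt (∑ i, ν i ^ 2) * ∑ i, v i ^ 2 := by
  obtain ⟨V, hV⟩ : ∃ V, V = ∑ i, v i ^ 2 := ⟨_, rfl⟩
  have hV0 : 0 ≤ V := hV ▸ Finset.sum_nonneg (fun i _ => sq_nonneg _)
  have h := Real.sum_mul_le_sqrt_mul_sqrt Finset.univ ν
    (fun i => V * (if i = n then 1 else 0) - 2 * v n * v i)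
  have h1 : ∑ i, ν i * (V * (if i = n then 1 else 0) - 2 * v n * v i)
      = ν n * V - 2 * v n * ∑ i, ν i * v i := by
    have : ∀ i, ν i * (V * (if i = n then 1 else 0) - 2 * v n * v i)
      = (if i = n then ν i * V else 0) - 2 * v n * (ν i * v i) := by
      intro i; split_ifs <;> ring
    simp only [this, Finset.sum_sub_distrib, ← Finset.mul_sum]
    simp
  have h2 : ∑ i, (V * (if i = n then 1 else 0) - 2 * v n * v i) ^ 2 = V ^ 2 := by
    have : ∀ i, (V * (if i = n then 1 else 0) - 2 * v n * v i) ^ 2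
      = (if i = n then V ^ 2 - 4 * V * v n * v i else 0) + 4 * v n ^ 2 * v i ^ 2 := by
      intro i; split_ifs <;> ring
    simp only [this, Finset.sum_add_distrib, ← Finset.mul_sum, ← hV]
    simp
    ring
  rw [h1, h2, Real.sqrt_sq hV0] at h
  rw [← hV]
  exact h


/-- Special case of Proposition 3.5: a single linear propensity w(x) = k·xₙ with
stoichiometric column ν gives the one-sided Lipschitz constant k(−νₙ + ‖ν‖)/2. -/
theorem stmt_9 (D : ℕ) (k : ℝ) (hk : 0 ≤ k) (ν : Fin D → ℝ) (n : Fin D)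
    (F : (Fin D → ℝ) → Fin D → ℝ)
    (hF : ∀ x i, F x i = -(ν i) * (k * x n)) :
    ∀ x y : Fin D → ℝ,
      ∑ i, (x i - y i) * (F x i - F y i) ≤
        k / 2 * (-(ν n) + Real.sqrt (∑ i, ν i ^ 2)) * ∑ i, (x i - y i) ^ 2 := by


  intro x y
  have h := mul_le_mul_of_nonneg_left (stmt_9_aux D ν (fun i => x i - y i) n)
    (by positivity : 0 ≤ k / 2)
  have e : ∑ i, (x i - y i) * (F x i - F y i)
      = -(k * (x n - y n)) * ∑ i, ν i * (x i - y i) := by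
    rw [Finset.mul_sum]
    refine Finset.sum_congr rfl fun i _ => ?_
    rw [hF, hF]; ring
  rw [e]
  linarith
end

section
/- Let S ∈ ℝ^{D×D} be symmetric, let ν ∈ ℝ^D, and define F : ℝ^D → ℝ^D by F(x) = −ν·(xᵀ S x). Then for all x, y ∈ ℝ^D, (x − y, F(x) − F(y)) ≤ ‖ν‖·‖S‖·‖x + y‖₁·‖x − y‖², where ‖S‖ denotes the spectral (Euclidean operator) norm of S. -/
open Matrix

theorem stmt_10_aux_l2 {D : ℕ} (s : Fin D → ℝ) :
    Real.sqrt (∑ i, s i ^ 2) ≤ ∑ i, |s i| := by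
  apply Real.sqrt_le_iff.mpr
  refine ⟨Finset.sum_nonneg fun i _ => abs_nonneg _, ?_⟩
  have := Finset.sum_sq_le_sq_sum_of_nonneg (s := Finset.univ) (f := fun i => |s i|)
    (fun i _ => abs_nonneg _)
  simpa [sq_abs] using this

theorem stmt_10_aux_norm {D : ℕ} (s : Fin D → ℝ) :
    ‖(WithLp.toLp 2 s : EuclideanSpace ℝ (Fin D))‖ = Real.sqrt (∑ i, s i ^ 2) := by
  simp [EuclideanSpace.norm_eq]

theorem stmt_10_aux_cs {D : ℕ} (s t : Fin D → ℝ) :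
    |s ⬝ᵥ t| ≤ Real.sqrt (∑ i, s i ^ 2) * Real.sqrt (∑ i, t i ^ 2) := by
  have h := abs_real_inner_le_norm (WithLp.toLp 2 s : EuclideanSpace ℝ (Fin D)) (WithLp.toLp 2 t)
  rw [stmt_10_aux_norm, stmt_10_aux_norm] at h
  simpa [EuclideanSpace.inner_eq_star_dotProduct, dotProduct_comm] using h

theorem stmt_10_aux_op {D : ℕ} (S : Matrix (Fin D) (Fin D) ℝ) (s : Fin D → ℝ) :
    Real.sqrt (∑ i, (S.mulVec s) i ^ 2) ≤
      ‖Matrix.toEuclideanCLM (𝕜 := ℝ) S‖ * Real.sqrt (∑ i, s i ^ 2) := by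
  have h := (Matrix.toEuclideanCLM (𝕜 := ℝ) S).le_opNorm (WithLp.toLp 2 s)
  rw [Matrix.toEuclideanCLM_toLp, stmt_10_aux_norm, stmt_10_aux_norm] at h
  exact h

/-- Proposition 3.6 (general quadratic case): the quadratic propensity w(x) = xᵀSx
with stoichiometric column ν has drift F(x) = −ν·w(x) satisfying the one-sided
estimate with constant μ ≤ ‖ν‖·‖S‖ (spectral norm of S). -/
theorem stmt_10 (D : ℕ) (S : Matrix (Fin D) (Fin D) ℝ) (hS : S.IsSymm)
    (ν : Fin D → ℝ)
    (F : (Fin D → ℝ) → Fin D → ℝ)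
    (hF : ∀ x i, F x i = -(ν i) * (x ⬝ᵥ S.mulVec x)) :
    ∀ x y : Fin D → ℝ,
      ∑ i, (x i - y i) * (F x i - F y i) ≤
        Real.sqrt (∑ i, ν i ^ 2) * ‖Matrix.toEuclideanCLM (𝕜 := ℝ) S‖ *
          (∑ i, |x i + y i|) * ∑ i, (x i - y i) ^ 2 := by
  intro x y
  have hsymm : x ⬝ᵥ S.mulVec y = y ⬝ᵥ S.mulVec x := by
    rw [dotProduct_mulVec, ← mulVec_transpose, hS.eq, dotProduct_comm]
  have hpol : x ⬝ᵥ S.mulVec x - y ⬝ᵥ S.mulVec y = (x - y) ⬝ᵥ S.mulVec (x + y) := by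
    rw [mulVec_add, sub_dotProduct, dotProduct_add, dotProduct_add, hsymm]; ring
  have hsum : ∑ i, (x i - y i) * (F x i - F y i) =
      -(((x - y) ⬝ᵥ ν) * ((x - y) ⬝ᵥ S.mulVec (x + y))) := by
    rw [← hpol]
    conv_rhs => rw [dotProduct]
    rw [Finset.sum_mul, ← Finset.sum_neg_distrib]
    refine Finset.sum_congr rfl fun i _ => ?_
    rw [hF, hF, Pi.sub_apply]; ring
  have h1 := stmt_10_aux_cs (x - y) ν
  have h2 := stmt_10_aux_cs (x - y) (S.mulVec (x + y))
  have h3 := stmt_10_aux_op S (x + y)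
  have h4 := stmt_10_aux_l2 (x + y)
  simp only [Pi.sub_apply, Pi.add_apply] at h1 h2 h3 h4
  have hd : Real.sqrt (∑ i, (x i - y i) ^ 2) * Real.sqrt (∑ i, (x i - y i) ^ 2)
      = ∑ i, (x i - y i) ^ 2 :=
    Real.mul_self_sqrt (Finset.sum_nonneg fun i _ => sq_nonneg _)
  rw [hsum]
  refine (neg_le_abs _).trans ?_
  rw [abs_mul, ← hd]
  set d := Real.sqrt (∑ i, (x i - y i) ^ 2)
  have h5 := h2.trans (mul_le_mul_of_nonneg_left
    (h3.trans (mul_le_mul_of_nonneg_left h4 (norm_nonneg _))) (Real.sqrt_nonneg _))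
  refine (mul_le_mul h1 h5 (abs_nonneg _) (by positivity)).trans (le_of_eq ?_)
  ring
end

section
/- Let k ≥ 0, let ν ∈ ℝ^D, let m, n ∈ {1,…,D} with m ≠ n, and define F : ℝ^D → ℝ^D by F(x) = −ν·(k·x_m·x_n). Then for all x, y ∈ ℝ₊^D, (x − y, F(x) − F(y)) ≤ (k/4)·max(−ν_m + ‖ν‖, −ν_n + ‖ν‖)·‖x + y‖₁·‖x − y‖². -/
theorem key_aux (D : ℕ) (ν d : Fin D → ℝ) (n : Fin D) :
    -((∑ i, d i * ν i) * d n) ≤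
      (-(ν n) + Real.sqrt (∑ i, ν i ^ 2)) / 2 * ∑ i, d i ^ 2 := by
  have hnn : 0 ≤ ∑ i, ν i ^ 2 := Finset.sum_nonneg fun i _ => sq_nonneg _
  have hN2 := Real.sq_sqrt hnn
  have hN := Real.sqrt_nonneg (∑ i, ν i ^ 2)
  set N := Real.sqrt (∑ i, ν i ^ 2) with hNdef
  rcases hN.eq_or_lt with h0 | hpos
  · have hz : ∑ i, ν i ^ 2 = 0 := by rw [← hN2, ← h0]; ring
    have hv : ∀ i, ν i = 0 := fun i => by
      have := (Finset.sum_eq_zero_iff_of_nonneg (fun i _ => sq_nonneg (ν i))).1 hz i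
        (Finset.mem_univ i)
      exact pow_eq_zero_iff (two_ne_zero) |>.1 this
    simp [hv, ← h0]
  · have cs := Finset.sum_mul_sq_le_sq_mul_sq Finset.univ d
      (fun i => ν i - N * (if i = n then 1 else 0))
    have e1 : ∑ i, d i * (ν i - N * (if i = n then 1 else 0)) = ∑ i, d i * ν i - N * d n := by
      simp [mul_sub, Finset.sum_sub_distrib, mul_comm]
    have e2 : ∑ i, (ν i - N * (if i = n then 1 else 0)) ^ 2 = 2 * N * (N - ν n) := by
      have : ∀ i, (ν i - N * (if i = n then 1 else 0)) ^ 2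
          = ν i ^ 2 + (if i = n then N ^ 2 - 2 * N * ν i else 0) := by
        intro i; split_ifs <;> ring
      simp only [this, Finset.sum_add_distrib, Finset.sum_ite_eq', Finset.mem_univ, if_true]
      rw [← hN2]; ring
    rw [e1, e2] at cs
    refine le_of_mul_le_mul_left ?_ (by positivity : 0 < 4 * N)
    nlinarith [sq_nonneg (∑ i, d i * ν i + N * d n)]

/-- Special case of Proposition 3.6: the bimolecular propensity w(x) = k·x_m·x_n
with stoichiometric column ν satisfies the one-sided estimate with
μ ≤ k·max_{j∈{m,n}}(−ν_j + ‖ν‖)/4 on the nonnegative orthant. -/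
theorem stmt_11 (D : ℕ) (k : ℝ) (hk : 0 ≤ k) (ν : Fin D → ℝ) (m n : Fin D) (hmn : m ≠ n)
    (F : (Fin D → ℝ) → Fin D → ℝ)
    (hF : ∀ x i, F x i = -(ν i) * (k * x m * x n)) :
    ∀ x y : Fin D → ℝ, (∀ i, 0 ≤ x i) → (∀ i, 0 ≤ y i) →
      ∑ i, (x i - y i) * (F x i - F y i) ≤
        k / 4 * max (-(ν m) + Real.sqrt (∑ i, ν i ^ 2))
                    (-(ν n) + Real.sqrt (∑ i, ν i ^ 2)) *
          (∑ i, |x i + y i|) * ∑ i, (x i - y i) ^ 2 := by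
  intro x y hx hy
  have hm := key_aux D ν (fun i => x i - y i) m
  have hn := key_aux D ν (fun i => x i - y i) n
  have hM0 : 0 ≤ -(ν m) + Real.sqrt (∑ i, ν i ^ 2) := by
    have h1 : ν m ^ 2 ≤ ∑ i, ν i ^ 2 :=
      Finset.single_le_sum (f := fun i => ν i ^ 2) (fun i _ => sq_nonneg _) (Finset.mem_univ m)
    have := Real.le_sqrt_of_sq_le h1
    linarith
  have hs : x m + y m + (x n + y n) ≤ ∑ i, |x i + y i| := by
    have h := Finset.sum_le_sum_of_subset_of_nonneg (f := fun i => |x i + y i|)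
      (Finset.subset_univ {m, n}) (fun i _ _ => abs_nonneg _)
    rw [Finset.sum_pair hmn] at h
    linarith [le_abs_self (x m + y m), le_abs_self (x n + y n)]
  have hL : ∑ i, (x i - y i) * (F x i - F y i)
      = -(∑ i, (x i - y i) * ν i) * (k * x m * x n - k * y m * y n) := by
    rw [← Finset.sum_neg_distrib, Finset.sum_mul]
    refine Finset.sum_congr rfl fun i _ => ?_
    rw [hF, hF]; ring
  rw [hL]
  have hd : 0 ≤ ∑ i, (x i - y i) ^ 2 := Finset.sum_nonneg fun i _ => sq_nonneg _
  have lm := le_max_left (-(ν m) + Real.sqrt (∑ i, ν i ^ 2)) (-(ν n) + Real.sqrt (∑ i, ν i ^ 2))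
  have ln := le_max_right (-(ν m) + Real.sqrt (∑ i, ν i ^ 2)) (-(ν n) + Real.sqrt (∑ i, ν i ^ 2))
  set M := max (-(ν m) + Real.sqrt (∑ i, ν i ^ 2)) (-(ν n) + Real.sqrt (∑ i, ν i ^ 2))
  have hM : 0 ≤ M := hM0.trans lm
  set P := ∑ i, (x i - y i) * ν i
  set Q := ∑ i, (x i - y i) ^ 2
  set S := ∑ i, |x i + y i|
  have hm' : -(P * (x m - y m)) ≤ M / 2 * Q :=
    hm.trans (mul_le_mul_of_nonneg_right (by linarith) hd)
  have hn' : -(P * (x n - y n)) ≤ M / 2 * Q :=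
    hn.trans (mul_le_mul_of_nonneg_right (by linarith) hd)
  have a1 := mul_le_mul_of_nonneg_left hm' (add_nonneg (hx n) (hy n))
  have a2 := mul_le_mul_of_nonneg_left hn' (add_nonneg (hx m) (hy m))
  have a3 := mul_le_mul_of_nonneg_left hs (mul_nonneg hM hd)
  have a4 : -P * (x m * x n - y m * y n) ≤ 1 / 4 * (M * Q * S) := by linarith
  have a5 := mul_le_mul_of_nonneg_left a4 hk
  linarith
end

section
/- Let N ∈ ℝ^{D×R} have columns N_r and let w : ℤ₊^D → ℝ^R have nonnegative components w_r. Let A, α, Γ, γ ∈ ℝ with Γ, γ ≥ 0, and assume that for all x ∈ ℤ₊^D: (𝟙, −N w(x)) ≤ A + α‖x‖₁ and Σ_{r=1}^R w_r(x) ≤ Γ + γ‖x‖₁². Then for every ε > 0 and every x ∈ ℤ₊^D, Σ_{r=1}^R (𝟙ᵀN_r)²·w_r(x) − 2·(𝟙ᵀ N w(x))·‖x‖₁ ≤ B + β·‖x‖₁², where β = (max_r (𝟙ᵀN_r)²)·γ + ε + 2α and B = (max_r (𝟙ᵀN_r)²)·Γ + A²/ε. -/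
open Matrix

/-- Proposition 4.5: under a first-order drift bound and quadratic growth of the
total propensity, the condition sufficient for mean-square boundedness holds with
β = ‖(𝟙ᵀN)²‖_∞·γ + ε + 2α and B = ‖(𝟙ᵀN)²‖_∞·Γ + A²/ε. -/
theorem stmt_13 (D R : ℕ) (hR : 0 < R)
    (N : Matrix (Fin D) (Fin R) ℝ) (w : (Fin D → ℝ) → Fin R → ℝ)
    (A α Γ γ : ℝ) (hΓ : 0 ≤ Γ) (hγ : 0 ≤ γ)
    (hw : ∀ x : Fin D → ℝ, (∀ i, ∃ m : ℕ, x i = m) → ∀ r, 0 ≤ w x r)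
    (h1 : ∀ x : Fin D → ℝ, (∀ i, ∃ m : ℕ, x i = m) →
      ∑ i, (-(N.mulVec (w x))) i ≤ A + α * ∑ i, |x i|)
    (h2 : ∀ x : Fin D → ℝ, (∀ i, ∃ m : ℕ, x i = m) →
      ∑ r, w x r ≤ Γ + γ * (∑ i, |x i|) ^ 2) :
    ∀ ε : ℝ, 0 < ε → ∀ x : Fin D → ℝ, (∀ i, ∃ m : ℕ, x i = m) →
      (∑ r, (∑ i, N i r) ^ 2 * w x r) - 2 * (∑ i, N.mulVec (w x) i) * (∑ i, |x i|) ≤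
        ((Finset.univ.sup' ⟨⟨0, hR⟩, Finset.mem_univ _⟩ fun r => (∑ i, N i r) ^ 2) * Γ
            + A ^ 2 / ε) +
        ((Finset.univ.sup' ⟨⟨0, hR⟩, Finset.mem_univ _⟩ fun r => (∑ i, N i r) ^ 2) * γ
            + ε + 2 * α) * (∑ i, |x i|) ^ 2 := by
  intro ε hε x hx
  have hmax : ∀ r, (∑ i, N i r) ^ 2 ≤
      (Finset.univ.sup' ⟨⟨0, hR⟩, Finset.mem_univ _⟩ fun r => (∑ i, N i r) ^ 2) := fun r =>
    Finset.le_sup' (fun r => (∑ i, N i r) ^ 2) (Finset.mem_univ r)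
  generalize (Finset.univ.sup' ⟨⟨0, hR⟩, Finset.mem_univ _⟩ fun r => (∑ i, N i r) ^ 2) = M
    at hmax ⊢
  have hM : 0 ≤ M := (sq_nonneg _).trans (hmax ⟨0, hR⟩)
  have hs : 0 ≤ ∑ i, |x i| := Finset.sum_nonneg fun i _ => abs_nonneg _
  have ha := h1 x hx
  have hb := h2 x hx
  simp only [Pi.neg_apply, Finset.sum_neg_distrib] at ha
  have hc : ∑ r, (∑ i, N i r) ^ 2 * w x r ≤ M * ∑ r, w x r := by
    rw [Finset.mul_sum]
    exact Finset.sum_le_sum fun r _ => mul_le_mul_of_nonneg_right (hmax r) (hw x hx r)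
  generalize (∑ i, |x i|) = s at *
  generalize (∑ i, N.mulVec (w x) i) = f at *
  have hd := mul_le_mul_of_nonneg_left hb hM
  have he := mul_le_mul_of_nonneg_right ha hs
  have hy : 2 * A * s ≤ A ^ 2 / ε + ε * s ^ 2 := by
    have h : A ^ 2 / ε + ε * s ^ 2 - 2 * A * s = (A - ε * s) ^ 2 / ε := by
      field_simp
      ring
    have : 0 ≤ (A - ε * s) ^ 2 / ε := by positivity
    linarith
  linarith
end

section
/- Fix an integer p > 2 and real constants A ≥ 0, α ∈ ℝ, Γ ≥ 0, γ ≥ 0, K ≥ 0. Then there exist constants B ≥ 0 and β ≥ 0 (depending only on p, A, α, Γ, γ, K) such that the following holds: for every D, R ≥ 1, every matrix N ∈ ℝ^{D×R} with columns N_r satisfying max_r |𝟙ᵀN_r| ≤ K, and every w : ℤ₊^D → ℝ^R with nonnegative components satisfying (𝟙, −N w(x)) ≤ A + α‖x‖₁ and Σ_{r=1}^R w_r(x) ≤ Γ + γ‖x‖₁² for all x ∈ ℤ₊^D, one has for every x ∈ ℤ₊^D: Σ_{r=1}^R w_r(x)·[ (𝟙ᵀx − 𝟙ᵀN_r)^p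 − (𝟙ᵀx)^p ] ≤ B + β·‖x‖₁^p. -/
open Matrix


lemma rem_bound (K : ℝ) (hK : 0 ≤ K) (q : ℕ) : ∃ C : ℝ, 0 ≤ C ∧ ∀ s n : ℝ, 0 ≤ s → |n| ≤ K →
    |(s - n) ^ (q + 2) - s ^ (q + 2) + (q + 2) * n * s ^ (q + 1)| ≤ C * (1 + s) ^ q := by
  induction q with
  | zero =>
    refine ⟨K ^ 2, by positivity, fun s n hs hn => ?_⟩
    have h : (s - n) ^ (0 + 2) - s ^ (0 + 2) + (((0 : ℕ) : ℝ) + 2) * n * s ^ (0 + 1) = n ^ 2 := by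
      push_cast; ring
    rw [h, abs_pow, pow_zero, mul_one]
    gcongr
  | succ q ih =>
    obtain ⟨C, hC, ih⟩ := ih
    refine ⟨(1 + K) * C + (q + 2) * K ^ 2, by positivity, fun s n hs hn => ?_⟩
    have h := ih s n hs hn
    set E := (s - n) ^ (q + 2) - s ^ (q + 2) + (q + 2) * n * s ^ (q + 1) with hE
    have h1 : (s - n) ^ (q + 1 + 2) - s ^ (q + 1 + 2) + (((q + 1 : ℕ) : ℝ) + 2) * n * s ^ (q + 1 + 1)
        = (s - n) * E + (q + 2) * n ^ 2 * s ^ (q + 1) := by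
      rw [hE]; push_cast; ring
    rw [h1]
    have h2 : |s - n| ≤ (1 + K) * (1 + s) := by
      have := abs_sub s n
      rw [abs_of_nonneg hs] at this
      nlinarith
    have h3 : n ^ 2 ≤ K ^ 2 := by rw [← sq_abs]; gcongr
    calc |(s - n) * E + (q + 2) * n ^ 2 * s ^ (q + 1)|
        ≤ |(s - n) * E| + |(q + 2) * n ^ 2 * s ^ (q + 1)| := abs_add_le _ _
      _ = |s - n| * |E| + (q + 2) * n ^ 2 * s ^ (q + 1) := by
        rw [abs_mul, abs_of_nonneg (a := (q + 2) * n ^ 2 * s ^ (q + 1)) (by positivity)]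
      _ ≤ ((1 + K) * (1 + s)) * (C * (1 + s) ^ q) + (q + 2) * K ^ 2 * (1 + s) ^ (q + 1) := by
        gcongr
        linarith
      _ = _ := by ring

/-- Key inequality in the proof of Theorem 4.6 (finite p-th moment bounds): the
generator applied to f(x) = (𝟙ᵀx)^p is bounded by B + β‖x‖₁^p, with constants
depending only on p, A, α, Γ, γ and the bound K on |𝟙ᵀN_r|. -/
theorem stmt_14 (p : ℕ) (hp : 2 < p) (A α Γ γ K : ℝ)
    (hA : 0 ≤ A) (hΓ : 0 ≤ Γ) (hγ : 0 ≤ γ) (hK : 0 ≤ K) :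
    ∃ B β : ℝ, 0 ≤ B ∧ 0 ≤ β ∧
      ∀ (D R : ℕ), 1 ≤ D → 1 ≤ R →
      ∀ (N : Matrix (Fin D) (Fin R) ℝ) (w : (Fin D → ℝ) → Fin R → ℝ),
        (∀ x : Fin D → ℝ, (∀ i, ∃ m : ℕ, x i = m) → ∀ r, 0 ≤ w x r) →
        (∀ r, |∑ i, N i r| ≤ K) →
        (∀ x : Fin D → ℝ, (∀ i, ∃ m : ℕ, x i = m) →
          ∑ i, (-(N.mulVec (w x))) i ≤ A + α * ∑ i, |x i|) →
        (∀ x : Fin D → ℝ, (∀ i, ∃ m : ℕ, x i = m) →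
          ∑ r, w x r ≤ Γ + γ * (∑ i, |x i|) ^ 2) →
        ∀ x : Fin D → ℝ, (∀ i, ∃ m : ℕ, x i = m) →
          ∑ r, w x r * (((∑ i, x i) - ∑ i, N i r) ^ p - (∑ i, x i) ^ p) ≤
            B + β * (∑ i, |x i|) ^ p := by
  obtain ⟨q, rfl⟩ : ∃ q, p = q + 2 := ⟨p - 2, by omega⟩
  obtain ⟨C, hC, hrem⟩ := rem_bound K hK q
  set M : ℝ := (q + 2) * (A + |α|) + C * (Γ + γ) with hM
  have hM0 : 0 ≤ M := by positivity
  refine ⟨M * 2 ^ (q + 2 - 1), M * 2 ^ (q + 2 - 1), by positivity, by positivity, ?_⟩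
  intro D R _ _ N w hw hN hd hs x hx
  have hxn : ∀ i, |x i| = x i := fun i => by
    obtain ⟨m, hm⟩ := hx i
    rw [hm]; exact abs_of_nonneg (Nat.cast_nonneg m)
  have hw := hw x hx
  have hd := hd x hx
  have hs := hs x hx
  simp only [hxn] at hd hs ⊢
  have hs0 : 0 ≤ ∑ i, x i := Finset.sum_nonneg fun i _ => by rw [← hxn i]; exact abs_nonneg _
  set s := ∑ i, x i
  have hdr : ∑ i, (-(N.mulVec (w x))) i = -∑ r, w x r * ∑ i, N i r := by
    simp only [Pi.neg_apply, Finset.sum_neg_distrib, Matrix.mulVec, dotProduct]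
    rw [Finset.sum_comm]
    congr 1
    refine Finset.sum_congr rfl fun r _ => ?_
    rw [Finset.mul_sum]
    exact Finset.sum_congr rfl fun i _ => mul_comm _ _
  rw [hdr] at hd
  have hα : α ≤ |α| := le_abs_self α
  have hA' : A + α * s ≤ (A + |α|) * (1 + s) := by
    nlinarith [abs_nonneg α, mul_nonneg hA hs0, mul_le_mul_of_nonneg_right hα hs0]
  have hΓ' : Γ + γ * s ^ 2 ≤ (Γ + γ) * (1 + s) ^ 2 := by
    nlinarith [mul_nonneg hΓ hs0, mul_nonneg hγ hs0, mul_nonneg hΓ (sq_nonneg s)]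
  calc ∑ r, w x r * ((s - ∑ i, N i r) ^ (q + 2) - s ^ (q + 2))
      ≤ ∑ r, w x r * (C * (1 + s) ^ q - (q + 2) * (∑ i, N i r) * s ^ (q + 1)) := by
        refine Finset.sum_le_sum fun r _ => mul_le_mul_of_nonneg_left ?_ (hw r)
        have := (abs_le.mp (hrem s _ hs0 (hN r))).2
        linarith
    _ = (q + 2) * s ^ (q + 1) * (-∑ r, w x r * ∑ i, N i r) + C * (1 + s) ^ q * ∑ r, w x r := by
        rw [mul_neg, Finset.mul_sum, Finset.mul_sum, ← Finset.sum_neg_distrib,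
          ← Finset.sum_add_distrib]
        exact Finset.sum_congr rfl fun r _ => by ring
    _ ≤ (q + 2) * s ^ (q + 1) * ((A + |α|) * (1 + s))
          + C * (1 + s) ^ q * ((Γ + γ) * (1 + s) ^ 2) := by
        gcongr
        · exact hd.trans hA'
        · exact hs.trans hΓ'
    _ ≤ (q + 2) * (1 + s) ^ (q + 1) * ((A + |α|) * (1 + s))
          + C * (1 + s) ^ q * ((Γ + γ) * (1 + s) ^ 2) := by
        gcongr
        linarith
    _ = M * (1 + s) ^ (q + 2) := by rw [hM]; ring
    _ ≤ M * (2 ^ (q + 2 - 1) * (1 ^ (q + 2) + s ^ (q + 2))) := by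
        gcongr
        exact add_pow_le zero_le_one hs0 _
    _ = _ := by rw [one_pow]; ring
end

section
/- Fix an integer p ≥ 2. Let N ∈ ℝ^{D×R} have columns N_r and let w : ℤ₊^D → ℝ^R have nonnegative components. Let A ≥ 0, α ∈ ℝ, Γ > 0, γ > 0 satisfy, for all x ∈ ℤ₊^D, (𝟙, −N w(x)) ≤ A + α‖x‖₁ and Σ_{r=1}^R w_r(x) ≤ Γ + γ‖x‖₁², and suppose that 2α + γ·(max_r (𝟙ᵀN_r)²)·(p−1) < 0. Then there exist constants C ≥ 0, K ≥ 0 and κ > 0 such that for all x ∈ ℤ₊^D: Σ_{r=1}^R w_r(x)·[ (C + 𝟙ᵀx − 𝟙ᵀN_r)^p − (C + 𝟙ᵀx)^p ] ≤ −κ·(C + 𝟙ᵀx)^p + K. -/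
open Matrix

lemma taylor_aux (L : ℝ) (hL : 0 ≤ L) (q : ℕ) : ∃ B : ℝ, 0 ≤ B ∧ ∀ y n : ℝ, 0 ≤ y → |n| ≤ L →
    |(y - n) ^ (q + 2) - (y ^ (q + 2) - (q + 2) * n * y ^ (q + 1)
      + (q + 2) * (q + 1) / 2 * n ^ 2 * y ^ q)| * (1 + y) ≤ B * (1 + y) ^ q := by
  induction q with
  | zero =>
    refine ⟨0, le_rfl, fun y n hy hn => ?_⟩
    have : (y - n) ^ (0 + 2) - (y ^ (0 + 2) - (((0 : ℕ) : ℝ) + 2) * n * y ^ (0 + 1)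
      + (((0 : ℕ) : ℝ) + 2) * (((0 : ℕ) : ℝ) + 1) / 2 * n ^ 2 * y ^ 0) = 0 := by
      push_cast; ring
    rw [this]; simp
  | succ q ih =>
    obtain ⟨B, hB, h⟩ := ih
    refine ⟨(1 + L) * B + L ^ 3 * ((q + 2) * (q + 1) / 2), by positivity, fun y n hy hn => ?_⟩
    have h := h y n hy hn
    set F := (y - n) ^ (q + 2) - (y ^ (q + 2) - (q + 2) * n * y ^ (q + 1)
      + (q + 2) * (q + 1) / 2 * n ^ 2 * y ^ q) with hF
    have e : (y - n) ^ (q + 1 + 2) - (y ^ (q + 1 + 2) - (((q + 1 : ℕ) : ℝ) + 2) * n * y ^ (q + 1 + 1)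
      + (((q + 1 : ℕ) : ℝ) + 2) * (((q + 1 : ℕ) : ℝ) + 1) / 2 * n ^ 2 * y ^ (q + 1))
      = (y - n) * F - n ^ 3 * ((q + 2) * (q + 1) / 2) * y ^ q := by
      rw [hF]; push_cast; ring
    rw [e]
    have a1 : |y - n| ≤ (1 + L) * (1 + y) := by
      have := abs_sub y n
      rw [abs_of_nonneg hy] at this
      nlinarith [mul_nonneg hL hy]
    have a2 : |n ^ 3 * (((q : ℝ) + 2) * (q + 1) / 2) * y ^ q|
        ≤ L ^ 3 * (((q : ℝ) + 2) * (q + 1) / 2) * (1 + y) ^ q := by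
      rw [abs_mul, abs_mul, abs_pow, abs_of_nonneg (by positivity : 0 ≤ ((q : ℝ) + 2) * (q + 1) / 2),
        abs_of_nonneg (by positivity : 0 ≤ y ^ q)]
      gcongr
      linarith
    calc _ ≤ (|y - n| * |F| + L ^ 3 * (((q : ℝ) + 2) * (q + 1) / 2) * (1 + y) ^ q) * (1 + y) := by
          gcongr
          refine (abs_sub _ _).trans ?_
          rw [abs_mul (y - n) F]
          gcongr
      _ = |y - n| * (|F| * (1 + y)) + L ^ 3 * (((q : ℝ) + 2) * (q + 1) / 2) * (1 + y) ^ (q + 1) := by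
          ring
      _ ≤ ((1 + L) * (1 + y)) * (B * (1 + y) ^ q)
          + L ^ 3 * (((q : ℝ) + 2) * (q + 1) / 2) * (1 + y) ^ (q + 1) := by
          gcongr
      _ = _ := by ring

lemma absorb_aux (H κ : ℝ) (hH : 0 ≤ H) (hκ : 0 < κ) (n : ℕ) :
    ∃ K : ℝ, 0 ≤ K ∧ ∀ y : ℝ, 0 ≤ y → H * (1 + y) ^ n ≤ κ * y ^ (n + 1) + K := by
  have hY : 0 ≤ max 1 (H * 2 ^ n / κ) := le_trans zero_le_one (le_max_left _ _)
  refine ⟨H * (1 + max 1 (H * 2 ^ n / κ)) ^ n, by positivity, fun y hy => ?_⟩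
  rcases le_total y (max 1 (H * 2 ^ n / κ)) with h | h
  · have : H * (1 + y) ^ n ≤ H * (1 + max 1 (H * 2 ^ n / κ)) ^ n := by gcongr
    have : 0 ≤ κ * y ^ (n + 1) := by positivity
    linarith
  · have h1 : 1 ≤ y := (le_max_left _ _).trans h
    have h2 : H * 2 ^ n ≤ y * κ := (div_le_iff₀ hκ).1 ((le_max_right _ _).trans h)
    have h3 : H * (1 + y) ^ n ≤ H * (2 * y) ^ n := by
      gcongr; linarith
    have h4 : H * 2 ^ n * y ^ n ≤ y * κ * y ^ n := by gcongr
    have h5 : 0 ≤ H * (1 + max 1 (H * 2 ^ n / κ)) ^ n := by positivity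
    rw [mul_pow] at h3
    rw [pow_succ]
    nlinarith

/-- Key negative-drift inequality in the proof of Theorem 4.10 (asymptotic
boundedness of the p-th moment): under the dissipativity condition
2α + γ·max_r(𝟙ᵀN_r)²·(p−1) < 0, the generator applied to f(x) = (C + 𝟙ᵀx)^p is
bounded by −κ(C + 𝟙ᵀx)^p + K for suitable C, K ≥ 0 and κ > 0. -/
theorem stmt_15 (p : ℕ) (hp : 2 ≤ p) (D R : ℕ) (hR : 0 < R)
    (N : Matrix (Fin D) (Fin R) ℝ) (w : (Fin D → ℝ) → Fin R → ℝ)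
    (A α Γ γ : ℝ) (hA : 0 ≤ A) (hΓ : 0 < Γ) (hγ : 0 < γ)
    (hw : ∀ x : Fin D → ℝ, (∀ i, ∃ m : ℕ, x i = m) → ∀ r, 0 ≤ w x r)
    (h1 : ∀ x : Fin D → ℝ, (∀ i, ∃ m : ℕ, x i = m) →
      ∑ i, (-(N.mulVec (w x))) i ≤ A + α * ∑ i, |x i|)
    (h2 : ∀ x : Fin D → ℝ, (∀ i, ∃ m : ℕ, x i = m) →
      ∑ r, w x r ≤ Γ + γ * (∑ i, |x i|) ^ 2)
    (hneg : 2 * α + γ * (Finset.univ.sup' ⟨⟨0, hR⟩, Finset.mem_univ _⟩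
      fun r => (∑ i, N i r) ^ 2) * ((p : ℝ) - 1) < 0) :
    ∃ C K κ : ℝ, 0 ≤ C ∧ 0 ≤ K ∧ 0 < κ ∧
      ∀ x : Fin D → ℝ, (∀ i, ∃ m : ℕ, x i = m) →
        ∑ r, w x r * ((C + (∑ i, x i) - ∑ i, N i r) ^ p - (C + ∑ i, x i) ^ p) ≤
          -κ * (C + ∑ i, x i) ^ p + K := by
  obtain ⟨q, rfl⟩ : ∃ q, p = q + 2 := ⟨p - 2, by omega⟩
  set M := Finset.univ.sup' ⟨⟨0, hR⟩, Finset.mem_univ _⟩ (fun r => (∑ i, N i r) ^ 2) with hM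
  have hMr : ∀ r, (∑ i, N i r) ^ 2 ≤ M := fun r =>
    Finset.le_sup' (fun r => (∑ i, N i r) ^ 2) (Finset.mem_univ r)
  have hM0 : 0 ≤ M := (sq_nonneg _).trans (hMr ⟨0, hR⟩)
  clear_value M
  have hLr : ∀ r, |∑ i, N i r| ≤ Real.sqrt M := fun r => Real.abs_le_sqrt (hMr r)
  obtain ⟨B, hB, hT⟩ := taylor_aux (Real.sqrt M) (Real.sqrt_nonneg _) q
  set c : ℝ := ((q : ℝ) + 2) * (q + 1) / 2 with hc
  have hc0 : 0 ≤ c := by positivity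
  set κ : ℝ := -(((q : ℝ) + 2) * α + γ * M * c) / 2 with hκd
  have hκ : 0 < κ := by
    push_cast at hneg
    have : ((q : ℝ) + 2) * α + γ * M * c
      = ((q : ℝ) + 2) / 2 * (2 * α + γ * M * ((q : ℝ) + 2 - 1)) := by rw [hc]; ring
    have h' : ((q : ℝ) + 2) / 2 * (2 * α + γ * M * ((q : ℝ) + 2 - 1)) < 0 :=
      mul_neg_of_pos_of_neg (by positivity) hneg
    rw [hκd]; linarith
  obtain ⟨K, hK, hKy⟩ := absorb_aux (((q : ℝ) + 2) * A + Γ * c * M + (Γ + γ) * B) κ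
    (by positivity) hκ (q + 1)
  refine ⟨0, K, κ, le_rfl, hK, hκ, fun x hx => ?_⟩
  have hxi : ∀ i, 0 ≤ x i := fun i => by
    obtain ⟨m, hm⟩ := hx i
    rw [hm]; positivity
  have habs : ∑ i, |x i| = ∑ i, x i := Finset.sum_congr rfl fun i _ => abs_of_nonneg (hxi i)
  have hy : 0 ≤ ∑ i, x i := Finset.sum_nonneg fun i _ => hxi i
  have g1 := h1 x hx
  have g2 := h2 x hx
  have hwx := hw x hx
  rw [habs] at g1 g2
  have e1 : ∑ i, (-(N.mulVec (w x))) i = -∑ r, w x r * ∑ i, N i r := by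
    simp only [Pi.neg_apply, Finset.sum_neg_distrib, Matrix.mulVec, dotProduct]
    rw [Finset.sum_comm]
    congr 1
    refine Finset.sum_congr rfl fun r _ => ?_
    rw [Finset.mul_sum]
    exact Finset.sum_congr rfl fun i _ => mul_comm _ _
  rw [e1] at g1
  set y := ∑ i, x i with hyd
  clear_value y
  simp only [zero_add]
  have hE : ∀ r, (y - ∑ i, N i r) ^ (q + 2) - y ^ (q + 2) ≤
      -((q + 2) * y ^ (q + 1)) * (∑ i, N i r) + (c * M * y ^ q + B * (1 + y) ^ q / (1 + y)) := by
    intro r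
    have h := hT y _ hy (hLr r)
    rw [← le_div_iff₀ (by positivity)] at h
    have h' := (le_abs_self _).trans h
    have h'' : c * (∑ i, N i r) ^ 2 * y ^ q ≤ c * M * y ^ q := by
      gcongr
      exact hMr r
    linarith
  have hcoef : 0 ≤ c * M * y ^ q + B * (1 + y) ^ q / (1 + y) := by positivity
  have hsum : ∑ r, w x r * ((y - ∑ i, N i r) ^ (q + 2) - y ^ (q + 2)) ≤
      ((q + 2) * y ^ (q + 1)) * (A + α * y)
        + (Γ + γ * y ^ 2) * (c * M * y ^ q + B * (1 + y) ^ q / (1 + y)) := by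
    calc _ ≤ ∑ r, w x r * (-((q + 2) * y ^ (q + 1)) * (∑ i, N i r)
            + (c * M * y ^ q + B * (1 + y) ^ q / (1 + y))) :=
          Finset.sum_le_sum fun r _ => mul_le_mul_of_nonneg_left (hE r) (hwx r)
      _ = ((q + 2) * y ^ (q + 1)) * (-∑ r, w x r * ∑ i, N i r)
            + (∑ r, w x r) * (c * M * y ^ q + B * (1 + y) ^ q / (1 + y)) := by
          rw [mul_neg, Finset.mul_sum, Finset.sum_mul, ← Finset.sum_neg_distrib,
            ← Finset.sum_add_distrib]
          exact Finset.sum_congr rfl fun r _ => by ring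
      _ ≤ _ := by gcongr
  have b1 : (Γ + γ * y ^ 2) * (B * (1 + y) ^ q / (1 + y)) ≤ (Γ + γ) * B * (1 + y) ^ (q + 1) := by
    have : Γ + γ * y ^ 2 ≤ (Γ + γ) * (1 + y) ^ 2 := by
      nlinarith [mul_nonneg hΓ.le hy, mul_nonneg hγ.le hy, mul_nonneg hΓ.le (sq_nonneg y)]
    calc _ ≤ ((Γ + γ) * (1 + y) ^ 2) * (B * (1 + y) ^ q / (1 + y)) := by gcongr
      _ = _ := by field_simp; ring
  have b2 : ((q : ℝ) + 2) * A * y ^ (q + 1) ≤ ((q : ℝ) + 2) * A * (1 + y) ^ (q + 1) := by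
    gcongr; linarith
  have b3 : Γ * c * M * y ^ q ≤ Γ * c * M * (1 + y) ^ (q + 1) := by
    have : y ^ q ≤ (1 + y) ^ (q + 1) :=
      (pow_le_pow_left₀ hy (by linarith) q).trans (pow_le_pow_right₀ (by linarith) (by omega))
    gcongr
  have b4 := hKy y hy
  have e2 : ((q : ℝ) + 2) * y ^ (q + 1) * (A + α * y)
        + (Γ + γ * y ^ 2) * (c * M * y ^ q + B * (1 + y) ^ q / (1 + y))
      = ((q : ℝ) + 2) * A * y ^ (q + 1) + Γ * c * M * y ^ q
        + (Γ + γ * y ^ 2) * (B * (1 + y) ^ q / (1 + y)) - 2 * κ * y ^ (q + 2) := by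
    rw [hκd]; ring
  have e3 : y ^ (q + 1 + 1) = y ^ (q + 2) := rfl
  rw [e3] at b4
  linarith
end

section
/- Let T ∈ (0, ∞], let u : [0,T) → ℝ be differentiable with u(0) > 0, u(t) > 0 for all t ∈ [0,T), and u'(t) ≥ 9·u(t)^{4/3} for all t ∈ [0,T). Then: (a) for every t ∈ [0,T) with 3t·u(0)^{1/3} < 1, one has u(t) ≥ u(0)/(1 − 3t·u(0)^{1/3})³; and consequently (b) T ≤ 1/(3·u(0)^{1/3}), i.e. u cannot be extended as a finite-valued solution beyond time 1/(3·u(0)^{1/3}). -/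
/-- Differential blow-up estimate at the core of Proposition 4.2: a positive
differentiable function on [0,T) with u' ≥ 9u^{4/3} satisfies the lower bound
u(t) ≥ u(0)/(1 − 3t·u(0)^{1/3})³, and consequently T ≤ 1/(3·u(0)^{1/3}). -/
theorem stmt_16 (T : EReal) (hT : 0 < T) (u u' : ℝ → ℝ)
    (hpos : ∀ t : ℝ, 0 ≤ t → (t : EReal) < T → 0 < u t)
    (hderiv : ∀ t : ℝ, 0 ≤ t → (t : EReal) < T →
      HasDerivWithinAt u (u' t) {s : ℝ | 0 ≤ s ∧ (s : EReal) < T} t)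
    (hineq : ∀ t : ℝ, 0 ≤ t → (t : EReal) < T → 9 * u t ^ ((4 : ℝ) / 3) ≤ u' t) :
    (∀ t : ℝ, 0 ≤ t → (t : EReal) < T → 3 * t * u 0 ^ ((1 : ℝ) / 3) < 1 →
      u 0 / (1 - 3 * t * u 0 ^ ((1 : ℝ) / 3)) ^ 3 ≤ u t) ∧
    T ≤ ((1 / (3 * u 0 ^ ((1 : ℝ) / 3)) : ℝ) : EReal) := by
  have h0 : 0 < u 0 := hpos 0 le_rfl (by simpa using hT)
  have ha : 0 < u 0 ^ ((1 : ℝ) / 3) := Real.rpow_pos_of_pos h0 _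
  have key : ∀ t : ℝ, 0 ≤ t → (t : EReal) < T →
      u 0 ^ ((1 : ℝ) / 3) ≤ u t ^ ((1 : ℝ) / 3) * (1 - 3 * t * u 0 ^ ((1 : ℝ) / 3)) := by
    intro t ht htT
    have hlt : ∀ s ∈ Set.Icc 0 t, (s : EReal) < T := fun s hs =>
      lt_of_le_of_lt (EReal.coe_le_coe_iff.2 hs.2) htT
    have hd : ∀ s ∈ Set.Icc 0 t, HasDerivWithinAt (fun s => u s ^ (-(1 : ℝ) / 3) + 3 * s)
        (u' s * (-(1 : ℝ) / 3) * u s ^ (-(1 : ℝ) / 3 - 1) + 3 * 1) (Set.Icc 0 t) s := by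
      intro s hs
      have h1 := (hderiv s hs.1 (hlt s hs)).mono
        (fun x hx => ⟨hx.1, hlt x hx⟩ : Set.Icc 0 t ⊆ {s : ℝ | 0 ≤ s ∧ (s : EReal) < T})
      exact (h1.rpow_const (Or.inl (hpos s hs.1 (hlt s hs)).ne')).add
        ((hasDerivWithinAt_id s _).const_mul 3)
    have hanti : AntitoneOn (fun s => u s ^ (-(1 : ℝ) / 3) + 3 * s) (Set.Icc 0 t) := by
      refine antitoneOn_of_hasDerivWithinAt_nonpos (convex_Icc 0 t)
        (fun s hs => (hd s hs).continuousWithinAt)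
        (fun s hs => (hd s (interior_subset hs)).mono interior_subset) ?_
      intro s hs
      have hs := interior_subset hs
      have hp := hpos s hs.1 (hlt s hs)
      have hi := hineq s hs.1 (hlt s hs)
      have hq : 0 < u s ^ (-(1 : ℝ) / 3 - 1) := Real.rpow_pos_of_pos hp _
      have hm : u s ^ ((4 : ℝ) / 3) * u s ^ (-(1 : ℝ) / 3 - 1) = 1 := by
        rw [← Real.rpow_add hp]; norm_num
      nlinarith [mul_le_mul_of_nonneg_right hi hq.le]
    have h := hanti (Set.left_mem_Icc.2 ht) (Set.right_mem_Icc.2 ht) ht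
    have hb : 0 < u t ^ ((1 : ℝ) / 3) := Real.rpow_pos_of_pos (hpos t ht htT) _
    simp only [neg_div, Real.rpow_neg h0.le, Real.rpow_neg (hpos t ht htT).le] at h
    generalize u 0 ^ ((1 : ℝ) / 3) = a at *
    generalize u t ^ ((1 : ℝ) / 3) = b at *
    have h2 := mul_le_mul_of_nonneg_right h (mul_pos ha hb).le
    have e1 : (b⁻¹ + 3 * t) * (a * b) = a + 3 * t * a * b := by field_simp
    have e2 : (a⁻¹ + 3 * 0) * (a * b) = b := by field_simp; ring
    rw [e1, e2] at h2
    linarith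
  have cube : ∀ x : ℝ, 0 < x → (x ^ ((1 : ℝ) / 3)) ^ 3 = x := by
    intro x hx
    rw [← Real.rpow_natCast, ← Real.rpow_mul hx.le]; norm_num
  constructor
  · intro t ht htT h1
    have hk := key t ht htT
    rw [div_le_iff₀ (pow_pos (by linarith) 3)]
    have := pow_le_pow_left₀ ha.le hk 3
    rwa [mul_pow, cube _ h0, cube _ (hpos t ht htT)] at this
  · by_contra! hc
    have hk := key _ (by positivity) hc
    have e : 3 * (1 / (3 * u 0 ^ ((1 : ℝ) / 3))) * u 0 ^ ((1 : ℝ) / 3) = 1 := by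
      field_simp
    rw [e] at hk
    linarith
end

section
/- Let β ∈ ℝ, and let u, a : [0,∞) → ℝ be functions with u differentiable and nonnegative, a continuous and nonnegative, such that for all t ≥ 0 the derivative of t ↦ u(t)² satisfies (u²)'(t) ≤ a(t)·u(t) + β·u(t)². Then for all t ≥ 0, u(t) ≤ exp(βt/2)·( u(0) + (1/2)·∫₀ᵗ a(s)·exp(−βs/2) ds ). -/
/-- Differential version of the Grönwall-type estimate Lemma 4.9:
if (u²)' ≤ a·u + β·u² with u differentiable and nonnegative and a continuous and
nonnegative, then u(t) ≤ e^{βt/2}(u(0) + ½∫₀ᵗ a(s)e^{−βs/2} ds). -/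
theorem stmt_17 (β : ℝ) (u u' a : ℝ → ℝ)
    (hu : ∀ t, 0 ≤ t → HasDerivWithinAt u (u' t) (Set.Ici 0) t)
    (hupos : ∀ t, 0 ≤ t → 0 ≤ u t)
    (ha : ContinuousOn a (Set.Ici 0))
    (hapos : ∀ t, 0 ≤ t → 0 ≤ a t)
    (hineq : ∀ t, 0 ≤ t → 2 * u t * u' t ≤ a t * u t + β * u t ^ 2) :
    ∀ t, 0 ≤ t →
      u t ≤ Real.exp (β * t / 2) *
        (u 0 + 1 / 2 * ∫ s in (0:ℝ)..t, a s * Real.exp (-(β * s) / 2)) := by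
  intro t ht
  have hb : Continuous (fun s : ℝ => a (max s 0) * Real.exp (-(β * s) / 2)) := by
    have h1 : Continuous (fun s : ℝ => a (max s 0)) :=
      ha.comp_continuous (by fun_prop) (fun s => le_max_right s 0)
    exact h1.mul (by fun_prop)
  have hint : ∫ s in (0:ℝ)..t, a s * Real.exp (-(β * s) / 2)
      = ∫ s in (0:ℝ)..t, a (max s 0) * Real.exp (-(β * s) / 2) := by
    apply intervalIntegral.integral_congr
    intro s hs
    rw [Set.uIcc_of_le ht] at hs
    simp only [max_eq_left hs.1]
  have hE : ∀ s : ℝ, HasDerivAt (fun s : ℝ => Real.exp (-(β * s) / 2))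
      (Real.exp (-(β * s) / 2) * (-β / 2)) s := by
    intro s
    have h := ((((hasDerivAt_id s).const_mul β).neg).div_const 2).exp
    simpa using h
  have hG : ∀ x : ℝ, HasDerivAt
      (fun x => ∫ s in (0:ℝ)..x, a (max s 0) * Real.exp (-(β * s) / 2))
      (a (max x 0) * Real.exp (-(β * x) / 2)) x := fun x =>
    hb.integral_hasStrictDerivAt 0 x |>.hasDerivAt
  have hmono : MonotoneOn (fun x =>
      1 / 2 * (∫ s in (0:ℝ)..x, a (max s 0) * Real.exp (-(β * s) / 2))
        - u x * Real.exp (-(β * x) / 2)) (Set.Ici 0) := by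
    apply monotoneOn_of_hasDerivWithinAt_nonneg (convex_Ici 0)
      (f' := fun x => 1 / 2 * (a (max x 0) * Real.exp (-(β * x) / 2))
        - (u' x * Real.exp (-(β * x) / 2) + u x * (Real.exp (-(β * x) / 2) * (-β / 2))))
    · intro x hx
      exact (((hG x).const_mul (1 / 2)).hasDerivWithinAt.sub
        ((hu x hx).mul (hE x).hasDerivWithinAt)).continuousWithinAt
    · intro x hx
      have hx' : x ∈ Set.Ici (0:ℝ) := interior_subset hx
      exact (((hG x).const_mul (1 / 2)).hasDerivWithinAt.sub
        (((hu x hx').mono interior_subset).mul (hE x).hasDerivWithinAt))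
    · intro x hx
      rw [interior_Ici, Set.mem_Ioi] at hx
      have hx0 := hx.le
      simp only [max_eq_left hx0]
      have key : 0 ≤ a x / 2 - u' x + β / 2 * u x := by
        rcases (hupos x hx0).eq_or_lt with h0 | h0
        · have hmin : IsLocalMin u x := by
            filter_upwards [Ioi_mem_nhds hx] with y hy
            rw [← h0]
            exact hupos y (le_of_lt hy)
          have := hmin.hasDerivAt_eq_zero ((hu x hx0).hasDerivAt (Ici_mem_nhds hx))
          rw [this, ← h0]
          have := hapos x hx0
          linarith
        · have h := hineq x hx0
          have h2 : 0 ≤ u x * (a x / 2 - u' x + β / 2 * u x) := by nlinarith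
          exact nonneg_of_mul_nonneg_right h2 h0
      have := mul_nonneg key (Real.exp_pos (-(β * x) / 2)).le
      linarith
  have h := hmono (Set.mem_Ici.2 le_rfl) (Set.mem_Ici.2 ht) ht
  simp only [intervalIntegral.integral_same, mul_zero, neg_zero, zero_div, Real.exp_zero,
    mul_one, zero_sub] at h
  rw [hint]
  have h3 : u t = Real.exp (β * t / 2) * (u t * Real.exp (-(β * t) / 2)) := by
    have : Real.exp (β * t / 2) * Real.exp (-(β * t) / 2) = 1 := by
      rw [← Real.exp_add, ← Real.exp_zero]; congr 1; ring
    linear_combination (-u t) * this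
  calc u t = _ := h3
    _ ≤ _ := mul_le_mul_of_nonneg_left (by linarith) (Real.exp_pos _).le
end

section
/- Let β ≥ 0, and let u, a : [0,∞) → ℝ be continuous nonnegative functions such that for all t ≥ 0, u(t)² ≤ u(0)² + ∫₀ᵗ ( a(s)·u(s) + β·u(s)² ) ds. Then for all t ≥ 0, u(t) ≤ exp(βt/2)·( u(0) + (1/2)·∫₀ᵗ a(s)·exp(−βs/2) ds ). -/
theorem stmt_18_aux (β : ℝ) (hβ : 0 ≤ β) (u a : ℝ → ℝ)
    (hu : Continuous u) (ha : Continuous a)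
    (hupos : ∀ t, 0 ≤ t → 0 ≤ u t) (hapos : ∀ t, 0 ≤ t → 0 ≤ a t)
    (hineq : ∀ t, 0 ≤ t →
      u t ^ 2 ≤ u 0 ^ 2 + ∫ s in (0:ℝ)..t, (a s * u s + β * u s ^ 2))
    (t : ℝ) (ht : 0 ≤ t) :
      u t ≤ Real.exp (β * t / 2) *
        (u 0 + 1 / 2 * ∫ s in (0:ℝ)..t, a s * Real.exp (-(β * s) / 2)) := by
  have key : ∀ ε : ℝ, 0 < ε → u t * Real.exp (-(β * t) / 2) ≤
      (u 0 + 1 / 2 * ∫ s in (0:ℝ)..t, a s * Real.exp (-(β * s) / 2)) + ε := by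
    intro ε hε
    have hfc : Continuous (fun s => a s * u s + β * u s ^ 2) := by fun_prop
    have hgc : Continuous (fun s => a s * Real.exp (-(β * s) / 2)) := by fun_prop
    set V : ℝ → ℝ := fun x => u 0 ^ 2 + ε ^ 2 + ∫ s in (0:ℝ)..x, (a s * u s + β * u s ^ 2) with hV
    have hVd : ∀ x, HasDerivAt V (a x * u x + β * u x ^ 2) x := fun x =>
      (hfc.integral_hasStrictDerivAt 0 x).hasDerivAt.const_add _
    have hVu : ∀ x, 0 ≤ x → u x ^ 2 + ε ^ 2 ≤ V x := by
      intro x hx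
      have := hineq x hx
      simp only [hV]; linarith
    have hVpos : ∀ x, 0 ≤ x → 0 < V x := fun x hx => by
      have := hVu x hx
      have h2 : 0 < ε ^ 2 := by positivity
      nlinarith [sq_nonneg (u x)]
    set D : ℝ → ℝ := fun x => Real.sqrt (V x) * Real.exp (-(β * x) / 2)
      - 1 / 2 * ∫ s in (0:ℝ)..x, a s * Real.exp (-(β * s) / 2) with hD
    have hDd : ∀ x, 0 ≤ x → HasDerivAt D
        ((a x * u x + β * u x ^ 2) / (2 * Real.sqrt (V x)) * Real.exp (-(β * x) / 2)
          + Real.sqrt (V x) * (Real.exp (-(β * x) / 2) * (-(β * 1) / 2))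
          - 1 / 2 * (a x * Real.exp (-(β * x) / 2))) x := by
      intro x hx
      have h1 := (hVd x).sqrt (hVpos x hx).ne'
      have h2 : HasDerivAt (fun x : ℝ => Real.exp (-(β * x) / 2))
          (Real.exp (-(β * x) / 2) * (-(β * 1) / 2)) x :=
        ((((hasDerivAt_id x).const_mul β).neg).div_const 2).exp
      have h3 := ((hgc.integral_hasStrictDerivAt 0 x).hasDerivAt).const_mul (1 / 2 : ℝ)
      exact (h1.mul h2).sub h3
    have hanti : AntitoneOn D (Set.Ici 0) := by
      apply antitoneOn_of_deriv_nonpos (convex_Ici 0)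
      · exact fun x hx => (hDd x hx).continuousAt.continuousWithinAt
      · intro x hx
        rw [interior_Ici] at hx
        exact (hDd x (le_of_lt hx)).differentiableAt.differentiableWithinAt
      · intro x hx
        rw [interior_Ici] at hx
        have hx0 : 0 ≤ x := le_of_lt hx
        rw [(hDd x hx0).deriv]
        have hv := Real.sqrt_pos.2 (hVpos x hx0)
        have huv : u x ≤ Real.sqrt (V x) := by
          apply Real.le_sqrt_of_sq_le
          nlinarith [hVu x hx0]
        set v := Real.sqrt (V x)
        have hq : (a x * u x + β * u x ^ 2) / (2 * v) ≤ (a x + β * v) / 2 := by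
          rw [div_le_div_iff₀ (by positivity) (by norm_num)]
          have e1 := mul_le_mul_of_nonneg_left huv (hapos x hx0)
          have e2 : β * u x ^ 2 ≤ β * v ^ 2 :=
            mul_le_mul_of_nonneg_left (pow_le_pow_left₀ (hupos x hx0) huv 2) hβ
          nlinarith
        have := mul_le_mul_of_nonneg_right hq (Real.exp_pos (-(β * x) / 2)).le
        nlinarith
    have h := hanti (Set.mem_Ici.2 le_rfl) (Set.mem_Ici.2 ht) ht
    have h0 : D 0 ≤ u 0 + ε := by
      simp only [hD, hV, intervalIntegral.integral_same]
      simp only [mul_zero, neg_zero, zero_div, Real.exp_zero, add_zero, sub_zero, mul_one]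
      have := hupos 0 le_rfl
      apply Real.sqrt_le_iff.2 ⟨by positivity, by nlinarith⟩
    have huv : u t ≤ Real.sqrt (V t) := by
      apply Real.le_sqrt_of_sq_le
      nlinarith [hVu t ht]
    have := mul_le_mul_of_nonneg_right huv (Real.exp_pos (-(β * t) / 2)).le
    simp only [hD] at h h0
    linarith
  have h := le_of_forall_pos_le_add key
  have h2 := mul_le_mul_of_nonneg_left h (Real.exp_pos (β * t / 2)).le
  have h3 : Real.exp (β * t / 2) * Real.exp (-(β * t) / 2) = 1 := by
    rw [← Real.exp_add, ← Real.exp_zero]; congr 1; ring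
  calc u t = Real.exp (β * t / 2) * (u t * Real.exp (-(β * t) / 2)) := by
        rw [mul_left_comm, h3, mul_one]
    _ ≤ _ := h2


/-- Integral version of the Grönwall-type estimate Lemma 4.9 (for β ≥ 0 and
without assuming differentiability of u). -/
theorem stmt_18 (β : ℝ) (hβ : 0 ≤ β) (u a : ℝ → ℝ)
    (hu : ContinuousOn u (Set.Ici 0)) (ha : ContinuousOn a (Set.Ici 0))
    (hupos : ∀ t, 0 ≤ t → 0 ≤ u t) (hapos : ∀ t, 0 ≤ t → 0 ≤ a t)
    (hineq : ∀ t, 0 ≤ t →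
      u t ^ 2 ≤ u 0 ^ 2 + ∫ s in (0:ℝ)..t, (a s * u s + β * u s ^ 2)) :
    ∀ t, 0 ≤ t →
      u t ≤ Real.exp (β * t / 2) *
        (u 0 + 1 / 2 * ∫ s in (0:ℝ)..t, a s * Real.exp (-(β * s) / 2)) := by
  intro t ht
  have hm : Continuous (fun s : ℝ => max s 0) := by fun_prop
  have hU : Continuous (fun s : ℝ => u (max s 0)) :=
    hu.comp_continuous hm (fun s => le_max_right s 0)
  have hA : Continuous (fun s : ℝ => a (max s 0)) :=
    ha.comp_continuous hm (fun s => le_max_right s 0)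
  have h := stmt_18_aux β hβ _ _ hU hA (fun s _ => hupos _ (le_max_right s 0))
    (fun s _ => hapos _ (le_max_right s 0)) (by
      intro x hx
      have e : ∫ s in (0:ℝ)..x, (a (max s 0) * u (max s 0) + β * u (max s 0) ^ 2)
          = ∫ s in (0:ℝ)..x, (a s * u s + β * u s ^ 2) := by
        apply intervalIntegral.integral_congr
        intro s hs
        rw [Set.uIcc_of_le hx] at hs
        simp only [max_eq_left hs.1]
      simp only [e, max_eq_left hx, max_self]
      exact hineq x hx) t ht
  have e : ∫ s in (0:ℝ)..t, a (max s 0) * Real.exp (-(β * s) / 2)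
      = ∫ s in (0:ℝ)..t, a s * Real.exp (-(β * s) / 2) := by
    apply intervalIntegral.integral_congr
    intro s hs
    rw [Set.uIcc_of_le ht] at hs
    simp only [max_eq_left hs.1]
  simp only [e, max_eq_left ht, max_self] at h
  exact h
end

section
/- Let β ∈ ℝ, and let u, a, g : [0,∞) → ℝ be functions with u differentiable and nonnegative, a and g continuous and nonnegative, such that for all t ≥ 0 the derivative of t ↦ u(t)² satisfies (u²)'(t) ≤ a(t)·u(t) + β·u(t)² + g(t). Then for all t ≥ 0, u(t) ≤ exp(βt/2)·[ ( u(0)² + ∫₀ᵗ exp(−βs)·g(s) ds )^{1/2} + (1/2)·∫₀ᵗ exp(−βs/2)·a(s) ds ]. -/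
open Set Filter Topology in
theorem gron_aux (v v' A G : ℝ → ℝ)
    (hv : ∀ t, 0 ≤ t → HasDerivWithinAt v (v' t) (Set.Ici 0) t)
    (hA : Continuous A) (hApos : ∀ t, 0 ≤ A t)
    (hG : Continuous G) (hGpos : ∀ t, 0 ≤ G t)
    (hineq : ∀ t, 0 ≤ t → 2 * v t * v' t ≤ A t * v t + G t) (h0 : 0 ≤ v 0)
    (T : ℝ) (hT : 0 ≤ T) :
    v T ≤ Real.sqrt (v 0 ^ 2 + ∫ s in (0:ℝ)..T, G s) + 1 / 2 * ∫ s in (0:ℝ)..T, A s := by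
  have key : ∀ ε : ℝ, 0 < ε → v T ≤ Real.sqrt (v 0 ^ 2 + ε + ∫ s in (0:ℝ)..T, G s)
      + 1 / 2 * (∫ s in (0:ℝ)..T, A s) + ε * T := by
    intro ε hε
    have hIG : ∀ x, 0 ≤ x → 0 ≤ ∫ s in (0:ℝ)..x, G s := fun x hx =>
      intervalIntegral.integral_nonneg hx (fun s _ => hGpos s)
    have hIA : ∀ x, 0 ≤ x → 0 ≤ ∫ s in (0:ℝ)..x, A s := fun x hx =>
      intervalIntegral.integral_nonneg hx (fun s _ => hApos s)
    have hpos : ∀ x, 0 ≤ x → 0 < v 0 ^ 2 + ε + ∫ s in (0:ℝ)..x, G s := fun x hx => by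
      have := hIG x hx
      positivity
    have hBd : ∀ x, 0 ≤ x → HasDerivAt (fun x => Real.sqrt (v 0 ^ 2 + ε + ∫ s in (0:ℝ)..x, G s)
        + 1 / 2 * (∫ s in (0:ℝ)..x, A s) + ε * x)
        (G x / (2 * Real.sqrt (v 0 ^ 2 + ε + ∫ s in (0:ℝ)..x, G s)) + 1 / 2 * A x + ε * 1) x := by
      intro x hx
      have h1 := (hG.integral_hasStrictDerivAt 0 x).hasDerivAt.const_add (v 0 ^ 2 + ε)
      have h2 := (hA.integral_hasStrictDerivAt 0 x).hasDerivAt.const_mul (1 / 2)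
      exact ((h1.sqrt (hpos x hx).ne').add h2).add ((hasDerivAt_id x).const_mul ε)
    refine image_le_of_deriv_right_lt_deriv_boundary' (f := v) (f' := v') (a := 0) (b := T)
      (B' := fun x => G x / (2 * Real.sqrt (v 0 ^ 2 + ε + ∫ s in (0:ℝ)..x, G s)) + 1 / 2 * A x + ε * 1)
      (B := fun x => Real.sqrt (v 0 ^ 2 + ε + ∫ s in (0:ℝ)..x, G s)
        + 1 / 2 * (∫ s in (0:ℝ)..x, A s) + ε * x)
      ?_ ?_ ?_ ?_ ?_ ?_ (right_mem_Icc.2 hT)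
    · exact fun x hx => (hv x hx.1).continuousWithinAt.mono Icc_subset_Ici_self
    · exact fun x hx => (hv x hx.1).mono (Ici_subset_Ici.2 hx.1)
    · simp only [intervalIntegral.integral_same, add_zero, mul_zero]
      apply Real.le_sqrt_of_sq_le
      linarith
    · exact fun x hx => (hBd x hx.1).continuousAt.continuousWithinAt
    · exact fun x hx => (hBd x hx.1).hasDerivWithinAt
    · intro x hx hxe
      have hs := Real.sqrt_pos.2 (hpos x hx.1)
      set S := Real.sqrt (v 0 ^ 2 + ε + ∫ s in (0:ℝ)..x, G s) with hS
      have hvS : S ≤ v x := by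
        have := hIA x hx.1
        have := mul_nonneg hε.le hx.1
        linarith
      have hvp : 0 < v x := hs.trans_le hvS
      have h3 := hineq x hx.1
      have h4 : G x / (2 * v x) ≤ G x / (2 * S) :=
        div_le_div_of_nonneg_left (hGpos x) (by positivity) (by linarith)
      have h5 : v' x ≤ G x / (2 * v x) + 1 / 2 * A x := by
        have : G x / (2 * v x) + 1 / 2 * A x = (A x * v x + G x) / (2 * v x) := by
          field_simp
          ring
        rw [this, le_div_iff₀ (by positivity)]
        linarith
      show v' x < G x / (2 * S) + 1 / 2 * A x + ε * 1
      linarith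
  have hc : Tendsto (fun ε : ℝ => Real.sqrt (v 0 ^ 2 + ε + ∫ s in (0:ℝ)..T, G s)
      + 1 / 2 * (∫ s in (0:ℝ)..T, A s) + ε * T) (𝓝[>] 0)
      (𝓝 (Real.sqrt (v 0 ^ 2 + 0 + ∫ s in (0:ℝ)..T, G s)
      + 1 / 2 * (∫ s in (0:ℝ)..T, A s) + 0 * T)) := by
    apply tendsto_nhdsWithin_of_tendsto_nhds
    apply Continuous.tendsto (f := fun ε : ℝ => Real.sqrt (v 0 ^ 2 + ε + ∫ s in (0:ℝ)..T, G s)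
      + 1 / 2 * (∫ s in (0:ℝ)..T, A s) + ε * T)
    fun_prop
  have := ge_of_tendsto hc (by
    filter_upwards [self_mem_nhdsWithin] with ε hε using key ε hε)
  simpa using this


/-- Extended Grönwall-type estimate (equations (4.25)–(4.26) of the paper):
if (u²)' ≤ a·u + β·u² + g, then
u(t) ≤ e^{βt/2}[(u(0)² + ∫₀ᵗ e^{−βs}g(s) ds)^{1/2} + ½∫₀ᵗ e^{−βs/2}a(s) ds]. -/
theorem stmt_19 (β : ℝ) (u u' a g : ℝ → ℝ)
    (hu : ∀ t, 0 ≤ t → HasDerivWithinAt u (u' t) (Set.Ici 0) t)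
    (hupos : ∀ t, 0 ≤ t → 0 ≤ u t)
    (ha : ContinuousOn a (Set.Ici 0)) (hapos : ∀ t, 0 ≤ t → 0 ≤ a t)
    (hg : ContinuousOn g (Set.Ici 0)) (hgpos : ∀ t, 0 ≤ t → 0 ≤ g t)
    (hineq : ∀ t, 0 ≤ t → 2 * u t * u' t ≤ a t * u t + β * u t ^ 2 + g t) :
    ∀ t, 0 ≤ t →
      u t ≤ Real.exp (β * t / 2) *
        (Real.sqrt (u 0 ^ 2 + ∫ s in (0:ℝ)..t, Real.exp (-(β * s)) * g s) +
          1 / 2 * ∫ s in (0:ℝ)..t, Real.exp (-(β * s) / 2) * a s) := by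

  intro t ht
  have hm : Continuous fun s : ℝ => max s 0 := by fun_prop
  have hac : Continuous fun s => a (max s 0) :=
    ha.comp_continuous hm (fun s => le_max_right s 0)
  have hgc : Continuous fun s => g (max s 0) :=
    hg.comp_continuous hm (fun s => le_max_right s 0)
  have hexp : ∀ x : ℝ, HasDerivAt (fun x => Real.exp (-(β * x) / 2))
      (Real.exp (-(β * x) / 2) * (-(β * 1) / 2)) x := fun x =>
    ((((hasDerivAt_id x).const_mul β).neg).div_const 2).exp
  have hsq : ∀ x : ℝ, Real.exp (-(β * x)) = Real.exp (-(β * x) / 2) ^ 2 := fun x => by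
    rw [← Real.exp_nat_mul]
    congr 1
    push_cast
    ring
  have h := gron_aux (fun x => Real.exp (-(β * x) / 2) * u x)
    (fun x => Real.exp (-(β * x) / 2) * (-(β * 1) / 2) * u x + Real.exp (-(β * x) / 2) * u' x)
    (fun s => Real.exp (-(β * s) / 2) * a (max s 0))
    (fun s => Real.exp (-(β * s)) * g (max s 0))
    (fun x hx => (hexp x).hasDerivWithinAt.mul (hu x hx))
    ((by fun_prop : Continuous fun s : ℝ => Real.exp (-(β * s) / 2)).mul hac) (fun s => mul_nonneg (Real.exp_pos _).le (hapos _ (le_max_right _ _)))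
    ((by fun_prop : Continuous fun s : ℝ => Real.exp (-(β * s))).mul hgc) (fun s => mul_nonneg (Real.exp_pos _).le (hgpos _ (le_max_right _ _)))
    (by
      intro x hx
      simp only [max_eq_left hx, hsq]
      have := mul_le_mul_of_nonneg_left (hineq x hx) (sq_nonneg (Real.exp (-(β * x) / 2)))
      linarith)
    (mul_nonneg (Real.exp_pos _).le (hupos 0 le_rfl)) t ht
  have e1 : ∫ s in (0:ℝ)..t, Real.exp (-(β * s) / 2) * a (max s 0)
      = ∫ s in (0:ℝ)..t, Real.exp (-(β * s) / 2) * a s := by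
    apply intervalIntegral.integral_congr
    intro s hs
    rw [Set.uIcc_of_le ht] at hs
    simp only [max_eq_left hs.1]
  have e2 : ∫ s in (0:ℝ)..t, Real.exp (-(β * s)) * g (max s 0)
      = ∫ s in (0:ℝ)..t, Real.exp (-(β * s)) * g s := by
    apply intervalIntegral.integral_congr
    intro s hs
    rw [Set.uIcc_of_le ht] at hs
    simp only [max_eq_left hs.1]
  rw [e1, e2] at h
  have e3 : Real.exp (-(β * 0) / 2) * u 0 = u 0 := by simp
  simp only [e3] at h
  have h6 := mul_le_mul_of_nonneg_left h (Real.exp_pos (β * t / 2)).le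
  rw [← mul_assoc, ← Real.exp_add] at h6
  have e4 : β * t / 2 + -(β * t) / 2 = 0 := by ring
  rwa [e4, Real.exp_zero, one_mul] at h6
end
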